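/- Let u be a positive singular solution of (-Δ)³u = c_n·u^{(n+6)/(n-6)} on ℝⁿ\{0}. Then -Δu is superharmonic away from the origin in the classical sense: Δ²u(x) = Δ(Δu)(x) ≥ 0 for every x ∈ ℝⁿ\{0}. -/

import Mathlib

noncomputable section

open Real

/-- The Euclidean Laplacian: the sum of the second partial derivatives. -/
def laplacian {n : ℕ} (u : EuclideanSpace ℝ (Fin n) → ℝ) (x : EuclideanSpace ℝ (Fin n)) : ℝ :=
  ∑ i : Fin n, iteratedFDeriv ℝ 2 u x ![EuclideanSpace.single i 1, EuclideanSpace.single i 1]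

def cN (n : ℕ) : ℝ := (n : ℝ) * ((n : ℝ) - 6) * ((n : ℝ) ^ 4 - 20 * (n : ℝ) ^ 2 + 64) / 64

open MeasureTheory Topology Filter
open scoped ContDiff Pointwise

theorem laplacian_eq_sum_fderiv {n : ℕ} (u : EuclideanSpace ℝ (Fin n) → ℝ)
    (x : EuclideanSpace ℝ (Fin n)) :
    laplacian u x = ∑ i : Fin n,
      fderiv ℝ (fderiv ℝ u) x (EuclideanSpace.single i 1) (EuclideanSpace.single i 1) := by
  simp [laplacian, iteratedFDeriv_two_apply]

theorem laplacian_eq_sum_fderiv_apply {n : ℕ} {u : EuclideanSpace ℝ (Fin n) → ℝ}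
    {x : EuclideanSpace ℝ (Fin n)} (hu : ContDiffAt ℝ 2 u x) :
    laplacian u x = ∑ i : Fin n,
      fderiv ℝ (fun y => fderiv ℝ u y (EuclideanSpace.single i 1)) x
        (EuclideanSpace.single i 1) := by
  rw [laplacian_eq_sum_fderiv]
  refine Finset.sum_congr rfl fun i _ => ?_
  have h : DifferentiableAt ℝ (fderiv ℝ u) x :=
    (hu.fderiv_right (m := 1) (by norm_num)).differentiableAt (by norm_num)
  exact ((h.hasFDerivAt.clm_apply (hasFDerivAt_const (EuclideanSpace.single i (1 : ℝ)) x)).fderiv ▸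
    by simp)

theorem laplacian_eventuallyEq {n : ℕ} {f g : EuclideanSpace ℝ (Fin n) → ℝ}
    {x : EuclideanSpace ℝ (Fin n)} (h : f =ᶠ[𝓝 x] g) : laplacian f =ᶠ[𝓝 x] laplacian g := by
  filter_upwards [(h.fderiv (𝕜 := ℝ)).fderiv (𝕜 := ℝ)] with y hy
  rw [laplacian_eq_sum_fderiv, laplacian_eq_sum_fderiv, hy]

@[simp]
theorem laplacian_const {n : ℕ} (c : ℝ) :
    laplacian (fun _ : EuclideanSpace ℝ (Fin n) => c) = fun _ => 0 := by
  ext x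
  simp [laplacian_eq_sum_fderiv]

theorem tsupport_laplacian_subset {n : ℕ} (f : EuclideanSpace ℝ (Fin n) → ℝ) :
    tsupport (laplacian f) ⊆ tsupport f := by
  intro x hx
  contrapose! hx
  rw [notMem_tsupport_iff_eventuallyEq] at hx ⊢
  refine (laplacian_eventuallyEq hx).trans ?_
  rw [Pi.zero_def, laplacian_const]

theorem HasCompactSupport.laplacian {n : ℕ} {f : EuclideanSpace ℝ (Fin n) → ℝ}
    (hf : HasCompactSupport f) : HasCompactSupport (laplacian f) :=
  hf.of_isClosed_subset (isClosed_tsupport _) (tsupport_laplacian_subset f)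

theorem ContDiffAt.laplacian_param {F : Type*} [NormedAddCommGroup F] [NormedSpace ℝ F] {n : ℕ}
    {f : F → EuclideanSpace ℝ (Fin n) → ℝ} {p : F × EuclideanSpace ℝ (Fin n)} {k m : ℕ∞ω}
    (hf : ContDiffAt ℝ k (Function.uncurry f) p) (hk : m + 2 ≤ k) :
    ContDiffAt ℝ m (Function.uncurry fun t => laplacian (f t)) p := by
  have h1 : ContDiffAt ℝ (m + 1)
      (fun q : F × EuclideanSpace ℝ (Fin n) => fderiv ℝ (f q.1) q.2) p :=
    ContDiffAt.fderiv (f := fun q : F × EuclideanSpace ℝ (Fin n) => f q.1) (g := Prod.snd) (n := k)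
      (hf.comp (p, p.2) (f := fun r => (r.1.1, r.2)) (by fun_prop)) (by fun_prop)
      (by rwa [add_assoc, one_add_one_eq_two])
  have h2 : ContDiffAt ℝ m
      (fun q : F × EuclideanSpace ℝ (Fin n) => fderiv ℝ (fderiv ℝ (f q.1)) q.2) p :=
    ContDiffAt.fderiv (f := fun q : F × EuclideanSpace ℝ (Fin n) => fderiv ℝ (f q.1))
      (g := Prod.snd) (n := m + 1)
      (h1.comp (p, p.2) (f := fun r => (r.1.1, r.2)) (by fun_prop)) (by fun_prop) le_rfl
  have : (Function.uncurry fun t => laplacian (f t)) = fun q => ∑ i : Fin n,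
      fderiv ℝ (fderiv ℝ (f q.1)) q.2 (EuclideanSpace.single i 1) (EuclideanSpace.single i 1) := by
    ext q
    exact laplacian_eq_sum_fderiv _ _
  rw [this]
  fun_prop

theorem ContDiffAt.laplacian {n : ℕ} {f : EuclideanSpace ℝ (Fin n) → ℝ}
    {x : EuclideanSpace ℝ (Fin n)} {k m : ℕ∞ω} (hf : ContDiffAt ℝ k f x) (hk : m + 2 ≤ k) :
    ContDiffAt ℝ m (laplacian f) x := by
  have := ContDiffAt.laplacian_param (f := fun _ : ℝ => f) (p := (0, x)) (m := m)
    (hf.comp (0, x) (f := Prod.snd) (by fun_prop)) hk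
  exact this.comp x (f := fun y => ((0 : ℝ), y)) (by fun_prop)

theorem ContDiff.laplacian {n : ℕ} {f : EuclideanSpace ℝ (Fin n) → ℝ} (hf : ContDiff ℝ ∞ f) :
    ContDiff ℝ ∞ (laplacian f) :=
  contDiff_iff_contDiffAt.2 fun _ => hf.contDiffAt.laplacian (m := ∞) le_rfl

theorem laplacian_const_mul_comp_smul {n : ℕ} (f : EuclideanSpace ℝ (Fin n) → ℝ) (a r : ℝ) :
    laplacian (fun y => a * f (r • y)) = fun x => a * r ^ 2 * laplacian f (r • x) := by
  ext x
  have h1 : fderiv ℝ (fun y => a * f (r • y)) = (a * r) • fun y => fderiv ℝ f (r • y) := by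
    ext1 y
    change fderiv ℝ (a • fun y => f (r • y)) y = _
    rw [fderiv_const_smul_field, Pi.smul_apply, fderiv_comp_smul, smul_smul]
    rfl
  have h2 : fderiv ℝ (fderiv ℝ fun y => a * f (r • y)) x =
      (a * r) • r • fderiv ℝ (fderiv ℝ f) (r • x) := by
    rw [h1, fderiv_const_smul_field (𝕜 := ℝ) (f := fun y => fderiv ℝ f (r • y)) (a * r),
      Pi.smul_apply, fderiv_comp_smul]
  rw [laplacian_eq_sum_fderiv, laplacian_eq_sum_fderiv, h2, Finset.mul_sum]
  refine Finset.sum_congr rfl fun i _ => ?_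
  simp only [_root_.smul_apply, smul_eq_mul]
  ring

theorem laplacian_comp_norm_sub_sq {n : ℕ} {F : ℝ → ℝ} (hF : ContDiff ℝ 2 F)
    (a : EuclideanSpace ℝ (Fin n)) :
    laplacian (fun y => F (‖y - a‖ ^ 2)) = fun x =>
      4 * ‖x - a‖ ^ 2 * deriv (deriv F) (‖x - a‖ ^ 2) + 2 * n * deriv F (‖x - a‖ ^ 2) := by
  ext x
  have hq : ∀ y, HasFDerivAt (fun y => ‖y - a‖ ^ 2) (2 • innerSL ℝ (y - a)) y := by
    intro y
    simpa using ((hasFDerivAt_id (𝕜 := ℝ) y).sub_const a).norm_sq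
  have hcomp : ContDiff ℝ 2 (fun y : EuclideanSpace ℝ (Fin n) => F (‖y - a‖ ^ 2)) :=
    hF.comp ((contDiff_id.sub contDiff_const).norm_sq ℝ)
  have hF' : ContDiff ℝ 1 (deriv F) :=
    (contDiff_succ_iff_deriv.1 (hF.of_le (by norm_num) : ContDiff ℝ (1 + 1) F)).2.2
  have h1 : ∀ (i : Fin n) y, fderiv ℝ (fun y => F (‖y - a‖ ^ 2)) y (EuclideanSpace.single i 1) =
      2 * (deriv F (‖y - a‖ ^ 2) * (y i - a i)) := by
    intro i y
    have := ((hF.differentiable (by norm_num) _).hasDerivAt.comp_hasFDerivAt y (hq y)).fderiv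
    rw [Function.comp_def] at this
    rw [this]
    simp [EuclideanSpace.inner_single_right]
    ring
  have h2 : ∀ i : Fin n, fderiv ℝ (fun y => 2 * (deriv F (‖y - a‖ ^ 2) * (y i - a i))) x
      (EuclideanSpace.single i 1) =
      4 * deriv (deriv F) (‖x - a‖ ^ 2) * (x i - a i) ^ 2 + 2 * deriv F (‖x - a‖ ^ 2) := by
    intro i
    have hA := (hF'.differentiable (by norm_num) _).hasDerivAt.comp_hasFDerivAt x (hq x)
    have hB : HasFDerivAt (fun y : EuclideanSpace ℝ (Fin n) => y i - a i)
        (EuclideanSpace.proj i : EuclideanSpace ℝ (Fin n) →L[ℝ] ℝ) x :=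
      (EuclideanSpace.proj i : EuclideanSpace ℝ (Fin n) →L[ℝ] ℝ).hasFDerivAt.sub_const _
    have := ((hA.mul hB).const_mul 2).fderiv
    simp only [Function.comp_def] at this
    refine (congrArg (fun T => T (EuclideanSpace.single i 1)) this).trans ?_
    simp [EuclideanSpace.inner_single_right]
    ring
  rw [laplacian_eq_sum_fderiv_apply hcomp.contDiffAt]
  simp_rw [h1, h2]
  rw [Finset.sum_add_distrib, ← Finset.mul_sum, EuclideanSpace.norm_sq_eq]
  simp
  ring

theorem integrable_mul_of_tsupport {n : ℕ} {f g : EuclideanSpace ℝ (Fin n) → ℝ}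
    (hf : ∀ x ∈ tsupport g, ContinuousAt f x) (hg : Continuous g) (hc : HasCompactSupport g) :
    Integrable (fun x => f x * g x) := by
  refine Continuous.integrable_of_hasCompactSupport ?_ hc.mul_left
  exact continuous_of_tsupport fun x hx =>
    (hf x (closure_mono (Function.support_mul_subset_right f g) hx)).mul hg.continuousAt

theorem integral_laplacian_mul {n : ℕ} {f g : EuclideanSpace ℝ (Fin n) → ℝ}
    (hf : ∀ x ∈ tsupport g, ContDiffAt ℝ 2 f x) (hg : ContDiff ℝ ∞ g) (hc : HasCompactSupport g) :
    ∫ x, laplacian f x * g x = ∫ x, f x * laplacian g x := by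
  have hsub : ∀ v : EuclideanSpace ℝ (Fin n), tsupport (fun x => fderiv ℝ g x v) ⊆ tsupport g :=
    fun v => tsupport_fderiv_apply_subset ℝ v
  have hsub2 : ∀ v : EuclideanSpace ℝ (Fin n),
      tsupport (fun x => fderiv ℝ (fun y => fderiv ℝ g y v) x v) ⊆ tsupport g :=
    fun v => (tsupport_fderiv_apply_subset ℝ v).trans (hsub v)
  have hg1 : ∀ v : EuclideanSpace ℝ (Fin n), ContDiff ℝ ∞ (fun x => fderiv ℝ g x v) := fun v =>
    (hg.fderiv_right (m := ∞) le_rfl).clm_apply contDiff_const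
  have hg2 : ∀ v : EuclideanSpace ℝ (Fin n),
      ContDiff ℝ ∞ (fun x => fderiv ℝ (fun y => fderiv ℝ g y v) x v) := fun v =>
    ((hg1 v).fderiv_right (m := ∞) le_rfl).clm_apply contDiff_const
  have hf1 : ∀ v, ∀ x ∈ tsupport g, ContDiffAt ℝ 1 (fun x => fderiv ℝ f x v) x := fun v x hx =>
    ((hf x hx).fderiv_right (m := 1) (by norm_num)).clm_apply contDiffAt_const
  have hf2 : ∀ v, ∀ x ∈ tsupport g,
      ContDiffAt ℝ 0 (fun x => fderiv ℝ (fun y => fderiv ℝ f y v) x v) x := fun v x hx =>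
    ((hf1 v x hx).fderiv_right (m := 0) (by norm_num)).clm_apply contDiffAt_const
  have hc1 : ∀ v : EuclideanSpace ℝ (Fin n), HasCompactSupport (fun x => fderiv ℝ g x v) :=
    fun v => hc.of_isClosed_subset (isClosed_tsupport _) (hsub v)
  have hc2 : ∀ v : EuclideanSpace ℝ (Fin n),
      HasCompactSupport (fun x => fderiv ℝ (fun y => fderiv ℝ g y v) x v) :=
    fun v => hc.of_isClosed_subset (isClosed_tsupport _) (hsub2 v)
  have hI2 : ∀ v, Integrable (fun x => fderiv ℝ (fun y => fderiv ℝ f y v) x v * g x) := fun v =>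
    integrable_mul_of_tsupport (fun x hx => (hf2 v x hx).continuousAt) hg.continuous hc
  have hI1 : ∀ v, Integrable (fun x => fderiv ℝ f x v * g x) := fun v =>
    integrable_mul_of_tsupport (fun x hx => (hf1 v x hx).continuousAt) hg.continuous hc
  have hI11 : ∀ v, Integrable (fun x => fderiv ℝ f x v * fderiv ℝ g x v) := fun v =>
    integrable_mul_of_tsupport (fun x hx => (hf1 v x (hsub v hx)).continuousAt)
      (hg1 v).continuous (hc1 v)
  have hI01 : ∀ v, Integrable (fun x => f x * fderiv ℝ g x v) := fun v =>
    integrable_mul_of_tsupport (fun x hx => (hf x (hsub v hx)).continuousAt)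
      (hg1 v).continuous (hc1 v)
  have hI02 : ∀ v, Integrable (fun x => f x * fderiv ℝ (fun y => fderiv ℝ g y v) x v) := fun v =>
    integrable_mul_of_tsupport (fun x hx => (hf x (hsub2 v hx)).continuousAt)
      (hg2 v).continuous (hc2 v)
  have key : ∀ v, ∫ x, fderiv ℝ (fun y => fderiv ℝ f y v) x v * g x =
      ∫ x, f x * fderiv ℝ (fun y => fderiv ℝ g y v) x v := by
    intro v
    have e1 := integral_mul_fderiv_eq_neg_fderiv_mul_of_integrable (hI2 v) (hI11 v) (hI1 v)
      (fun x hx => (hf1 v x hx).differentiableAt one_ne_zero)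
      (fun x _ => hg.differentiable (by simp) x)
    have e2 := integral_mul_fderiv_eq_neg_fderiv_mul_of_integrable (hI11 v) (hI02 v) (hI01 v)
      (fun x hx => (hf x (hsub v hx)).differentiableAt two_ne_zero)
      (fun x _ => (hg1 v).differentiable (by simp) x)
    linarith
  have eL : ∀ x, laplacian f x * g x = ∑ i : Fin n,
      fderiv ℝ (fun y => fderiv ℝ f y (EuclideanSpace.single i 1)) x
        (EuclideanSpace.single i 1) * g x := by
    intro x
    by_cases hx : x ∈ tsupport g
    · rw [laplacian_eq_sum_fderiv_apply (hf x hx), Finset.sum_mul]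
    · simp [image_eq_zero_of_notMem_tsupport hx]
  have eR : ∀ x, f x * laplacian g x = ∑ i : Fin n,
      f x * fderiv ℝ (fun y => fderiv ℝ g y (EuclideanSpace.single i 1)) x
        (EuclideanSpace.single i 1) := by
    intro x
    rw [laplacian_eq_sum_fderiv_apply (contDiff_infty.1 hg 2).contDiffAt, Finset.mul_sum]
  simp_rw [eL, eR]
  rw [integral_finsetSum _ fun i _ => hI2 _, integral_finsetSum _ fun i _ => hI02 _]
  exact Finset.sum_congr rfl fun i _ => key _

theorem integral_laplacian_iterate_mul {n : ℕ} {f g : EuclideanSpace ℝ (Fin n) → ℝ}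
    (hf : ∀ x, x ≠ 0 → ContDiffAt ℝ 6 f x) (hg : ContDiff ℝ ∞ g) (hc : HasCompactSupport g)
    (h0 : (0 : EuclideanSpace ℝ (Fin n)) ∉ tsupport g) :
    ∫ x, laplacian (laplacian (laplacian f)) x * g x =
      ∫ x, f x * laplacian (laplacian (laplacian g)) x := by
  have hne : ∀ x ∈ tsupport g, x ≠ 0 := fun x hx h => h0 (h ▸ hx)
  have hf1 : ∀ x, x ≠ 0 → ContDiffAt ℝ 4 (laplacian f) x :=
    fun x hx => (hf x hx).laplacian (by norm_num)
  have hf2 : ∀ x, x ≠ 0 → ContDiffAt ℝ 2 (laplacian (laplacian f)) x :=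
    fun x hx => (hf1 x hx).laplacian (by norm_num)
  have hs1 := tsupport_laplacian_subset g
  have hs2 := (tsupport_laplacian_subset (laplacian g)).trans hs1
  rw [integral_laplacian_mul (fun x hx => hf2 x (hne x hx)) hg hc,
    integral_laplacian_mul (fun x hx => (hf1 x (hne x (hs1 hx))).of_le (by norm_num)) hg.laplacian
      hc.laplacian,
    integral_laplacian_mul (fun x hx => (hf x (hne x (hs2 hx))).of_le (by norm_num))
      hg.laplacian.laplacian hc.laplacian.laplacian]

theorem exists_deriv_pow_mul {η A : ℝ → ℝ} (hη : ContDiff ℝ ∞ η) (hA : ContDiff ℝ ∞ A) (k : ℕ) :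
    ∃ B : ℝ → ℝ, ContDiff ℝ ∞ B ∧
      deriv (fun s => η s ^ (k + 1) * A s) = fun s => η s ^ k * B s := by
  have hη' : ContDiff ℝ ∞ (deriv η) := (contDiff_infty_iff_deriv.1 hη).2
  have hA' : ContDiff ℝ ∞ (deriv A) := (contDiff_infty_iff_deriv.1 hA).2
  refine ⟨fun s => (k + 1) * deriv η s * A s + η s * deriv A s, by fun_prop, ?_⟩
  ext s
  have h1 := (hη.differentiable (by simp) s).hasDerivAt
  have h2 := (hA.differentiable (by simp) s).hasDerivAt
  refine ((h1.pow (k + 1)).mul h2).deriv.trans ?_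
  simp
  ring

theorem exists_laplacian_pow_mul {η A : ℝ → ℝ} (hη : ContDiff ℝ ∞ η) (hA : ContDiff ℝ ∞ A)
    (n k : ℕ) : ∃ B : ℝ → ℝ, ContDiff ℝ ∞ B ∧
      laplacian (fun x : EuclideanSpace ℝ (Fin n) => η (‖x‖ ^ 2) ^ (k + 2) * A (‖x‖ ^ 2)) =
        fun x => η (‖x‖ ^ 2) ^ k * B (‖x‖ ^ 2) := by
  obtain ⟨B₁, hB₁, e₁⟩ := exists_deriv_pow_mul hη hA (k + 1)
  obtain ⟨B₂, hB₂, e₂⟩ := exists_deriv_pow_mul hη hB₁ k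
  refine ⟨fun s => 4 * s * B₂ s + 2 * n * (η s * B₁ s), by fun_prop, ?_⟩
  have hF : ContDiff ℝ 2 (fun s => η s ^ (k + 2) * A s) :=
    contDiff_infty.1 ((hη.pow _).mul hA) 2
  have := laplacian_comp_norm_sub_sq (n := n) hF 0
  simp only [sub_zero] at this
  rw [this]
  ext x
  rw [e₁, e₂]
  ring

theorem exists_mul_le_half_rpow_add {p c C : ℝ} (hp : 1 < p) (hc : 0 < c) (hC : 0 < C) :
    ∃ K, 0 ≤ K ∧ ∀ a, 0 ≤ a → C * a ≤ c * a ^ p / 2 + K := by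
  have hM : 0 < 2 * C / c := by positivity
  refine ⟨C * (2 * C / c) ^ (p - 1)⁻¹, by positivity, fun a ha => ?_⟩
  rcases le_total a ((2 * C / c) ^ (p - 1)⁻¹) with h | h
  · have : 0 ≤ c * a ^ p / 2 := by positivity
    have := mul_le_mul_of_nonneg_left h hC.le
    linarith
  · have ha' : 0 < a := lt_of_lt_of_le (by positivity) h
    have h1 : 2 * C / c ≤ a ^ (p - 1) := by
      have := Real.rpow_le_rpow (by positivity) h (sub_pos.2 hp).le
      rwa [← Real.rpow_mul hM.le, inv_mul_cancel₀ (sub_pos.2 hp).ne', Real.rpow_one] at this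
    rw [div_le_iff₀ hc] at h1
    have h2 : a ^ p = a ^ (p - 1) * a := by
      rw [← Real.rpow_add_one ha'.ne', sub_add_cancel]
    have : 0 ≤ C * (2 * C / c) ^ (p - 1)⁻¹ := by positivity
    rw [h2]
    nlinarith

theorem cN_pos {n : ℕ} (hn : 7 ≤ n) : 0 < cN n := by
  have h : (7 : ℝ) ≤ n := by exact_mod_cast hn
  have h1 : 0 < (n : ℝ) ^ 4 - 20 * (n : ℝ) ^ 2 + 64 := by
    have : (n : ℝ) ^ 4 - 20 * (n : ℝ) ^ 2 + 64 = ((n : ℝ) ^ 2 - 16) * ((n : ℝ) ^ 2 - 4) := by ring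
    rw [this]
    exact mul_pos (by nlinarith) (by nlinarith)
  have : 0 < (n : ℝ) - 6 := by linarith
  unfold cN
  positivity

/-- A positive solution of `(-Δ)³w = c w ^ ((n+6)/(n-6))` on the punctured space. -/
structure IsPuncturedSolution {n : ℕ} (c : ℝ) (w : EuclideanSpace ℝ (Fin n) → ℝ) : Prop where
  pos : ∀ x, x ≠ 0 → 0 < w x
  contDiffAt : ∀ x, x ≠ 0 → ContDiffAt ℝ 6 w x
  eq : ∀ x, x ≠ 0 →
    -laplacian (laplacian (laplacian w)) x = c * w x ^ (((n : ℝ) + 6) / ((n : ℝ) - 6))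

theorem IsPuncturedSolution.rescale {n : ℕ} (hn : 7 ≤ n) {c r : ℝ}
    {w : EuclideanSpace ℝ (Fin n) → ℝ} (hw : IsPuncturedSolution c w) (hr : 0 < r) :
    IsPuncturedSolution c (fun z => r ^ (((n : ℝ) - 6) / 2) * w (r • z)) := by
  have hn' : (0 : ℝ) < n - 6 := by
    have : (7 : ℝ) ≤ n := by exact_mod_cast hn
    linarith
  have hne : ∀ x : EuclideanSpace ℝ (Fin n), x ≠ 0 → r • x ≠ 0 :=
    fun x hx => smul_ne_zero hr.ne' hx
  refine ⟨fun x hx => mul_pos (by positivity) (hw.pos _ (hne x hx)), fun x hx => ?_,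
    fun x hx => ?_⟩
  · exact contDiffAt_const.mul ((hw.contDiffAt _ (hne x hx)).comp x (f := fun z => r • z)
      (contDiff_const_smul r).contDiffAt)
  · simp only [laplacian_const_mul_comp_smul]
    rw [Real.mul_rpow (by positivity) (hw.pos _ (hne x hx)).le, ← Real.rpow_mul hr.le]
    have h1 : ((n : ℝ) - 6) / 2 * ((n + 6) / (n - 6)) = ((n : ℝ) - 6) / 2 + (6 : ℕ) := by
      field_simp
      push_cast
      ring
    rw [h1, Real.rpow_add_natCast hr.ne']
    linear_combination (r ^ (((n : ℝ) - 6) / 2) * r ^ 6) * hw.eq _ (hne x hx)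

theorem isCompact_annulus {n : ℕ} (r R : ℝ) :
    IsCompact {x : EuclideanSpace ℝ (Fin n) | r ≤ ‖x‖ ∧ ‖x‖ ≤ R} := by
  refine (isCompact_closedBall 0 R).of_isClosed_subset ?_ fun x hx => ?_
  · exact IsClosed.and (isClosed_le continuous_const continuous_norm)
      (isClosed_le continuous_norm continuous_const)
  · simpa using hx.2

theorem exists_integral_annulus_le {n : ℕ} (hn : 7 ≤ n) {c : ℝ} (hc : 0 < c) :
    ∃ C, 0 ≤ C ∧ ∀ w : EuclideanSpace ℝ (Fin n) → ℝ, IsPuncturedSolution c w →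
      ∫ z in {z | 1 ≤ ‖z‖ ∧ ‖z‖ ≤ 2}, w z ≤ C := by
  obtain ⟨m, rfl⟩ := Nat.exists_eq_add_of_le' hn
  let η : ContDiffBump (5 / 2 : ℝ) := ⟨3 / 2, 2, by norm_num, by norm_num⟩
  have hη : ContDiff ℝ ∞ η := η.contDiff
  have hη0 : ∀ s, ¬ (1 / 2 ≤ s ∧ s ≤ 9 / 2) → η s = 0 := by
    intro s hs
    refine η.zero_of_le_dist ?_
    rw [Real.dist_eq, le_abs]
    change 2 ≤ _ ∨ 2 ≤ _
    by_contra! h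
    exact hs ⟨by linarith, by linarith⟩
  have hη1 : ∀ s, 1 ≤ s → s ≤ 4 → η s = 1 := by
    intro s h1 h4
    refine η.one_of_mem_closedBall ?_
    rw [Metric.mem_closedBall, Real.dist_eq, abs_le]
    change - (3 / 2) ≤ _ ∧ _ ≤ 3 / 2
    constructor <;> linarith
  obtain ⟨B₁, hB₁, e₁⟩ := exists_laplacian_pow_mul hη (contDiff_const (c := 1)) (m + 7) (m + 11)
  obtain ⟨B₂, hB₂, e₂⟩ := exists_laplacian_pow_mul hη hB₁ (m + 7) (m + 9)
  obtain ⟨B, hB, e₃⟩ := exists_laplacian_pow_mul hη hB₂ (m + 7) (m + 7)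
  simp only [mul_one] at e₁
  obtain ⟨M, hM⟩ := (isCompact_Icc (a := (1 / 2 : ℝ)) (b := 9 / 2)).exists_bound_of_continuousOn
    hB.continuous.continuousOn
  have hM0 : 0 ≤ M := (norm_nonneg _).trans (hM 1 (by norm_num))
  have hp : 1 < (((m + 7 : ℕ) : ℝ) + 6) / (((m + 7 : ℕ) : ℝ) - 6) := by
    push_cast
    rw [lt_div_iff₀ (by linarith [(Nat.cast_nonneg m : (0 : ℝ) ≤ m)])]
    linarith
  set p : ℝ := (((m + 7 : ℕ) : ℝ) + 6) / (((m + 7 : ℕ) : ℝ) - 6) with hp_def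
  obtain ⟨K, hK, hY⟩ := exists_mul_le_half_rpow_add hp hc (show 0 < M + 1 by linarith)
  let S : Set (EuclideanSpace ℝ (Fin (m + 7))) := Metric.closedBall 0 3
  refine ⟨2 * (K * volume.real S), by positivity, fun w hw => ?_⟩
  have hpow_smooth : ∀ k : ℕ,
      ContDiff ℝ ∞ (fun z : EuclideanSpace ℝ (Fin (m + 7)) => η (‖z‖ ^ 2) ^ k) := fun k =>
    (hη.comp (contDiff_id.norm_sq ℝ)).pow k
  have hts : ∀ k : ℕ, tsupport (fun z : EuclideanSpace ℝ (Fin (m + 7)) => η (‖z‖ ^ 2) ^ (k + 1)) ⊆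
      {z | 1 / 2 ≤ ‖z‖ ^ 2 ∧ ‖z‖ ^ 2 ≤ 9 / 2} := by
    intro k
    refine closure_minimal (fun z hz => ?_) ?_
    · by_contra h
      exact hz (by simp [hη0 _ h])
    · exact IsClosed.and (isClosed_le continuous_const (by fun_prop))
        (isClosed_le (by fun_prop) continuous_const)
  have hcs : ∀ k : ℕ, HasCompactSupport
      (fun z : EuclideanSpace ℝ (Fin (m + 7)) => η (‖z‖ ^ 2) ^ (k + 1)) := by
    intro k
    refine (isCompact_closedBall 0 3).of_isClosed_subset (isClosed_tsupport _)
      ((hts k).trans fun z hz => ?_)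
    rw [mem_closedBall_zero_iff]
    nlinarith [hz.2, norm_nonneg z]
  have hne : ∀ k : ℕ, ∀ z ∈ tsupport
      (fun z : EuclideanSpace ℝ (Fin (m + 7)) => η (‖z‖ ^ 2) ^ (k + 1)), z ≠ 0 := by
    rintro k z hz rfl
    have := (hts k hz).1
    norm_num at this
  have hη00 : η (‖(0 : EuclideanSpace ℝ (Fin (m + 7)))‖ ^ 2) = 0 := hη0 _ (by norm_num)
  set a : EuclideanSpace ℝ (Fin (m + 7)) → ℝ := fun z => w z * η (‖z‖ ^ 2) ^ (m + 1) with ha_def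
  have ha0 : ∀ z, 0 ≤ a z := by
    intro z
    rcases eq_or_ne z 0 with rfl | hz
    · simp only [ha_def, hη00]
      rw [zero_pow (by simp), mul_zero]
    · exact mul_nonneg (hw.pos z hz).le (pow_nonneg η.nonneg _)
  have hap : ∀ z, a z ^ p = w z ^ p * η (‖z‖ ^ 2) ^ (m + 12 + 1) := by
    intro z
    rcases eq_or_ne z 0 with rfl | hz
    · simp only [ha_def, hη00]
      rw [zero_pow (by simp), zero_pow (by simp), mul_zero, mul_zero, Real.zero_rpow (by linarith)]
    · rw [ha_def]
      dsimp only
      rw [Real.mul_rpow (hw.pos z hz).le (pow_nonneg η.nonneg _), ← Real.rpow_natCast,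
        ← Real.rpow_mul η.nonneg, ← Real.rpow_natCast _ (m + 12 + 1)]
      congr 2
      have : (0 : ℝ) < m + 1 := by positivity
      rw [hp_def]
      push_cast
      rw [show (m : ℝ) + 7 - 6 = m + 1 by ring]
      field_simp
      ring
  have ha_int : Integrable a := integrable_mul_of_tsupport
    (fun z hz => (hw.contDiffAt z (hne _ z hz)).continuousAt) (hpow_smooth _).continuous (hcs m)
  have hap_int : Integrable (fun z => a z ^ p) := by
    simp_rw [hap]
    exact integrable_mul_of_tsupport (fun z hz =>
      (hw.contDiffAt z (hne _ z hz)).continuousAt.rpow_const (Or.inl (hw.pos z (hne _ z hz)).ne'))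
      (hpow_smooth _).continuous (hcs (m + 12))
  have h3 := integral_laplacian_iterate_mul hw.contDiffAt (hpow_smooth _) (hcs (m + 12))
    (fun h => hne _ _ h rfl)
  have h4 : c * ∫ z, a z ^ p = -∫ z, w z * (η (‖z‖ ^ 2) ^ (m + 7) * B (‖z‖ ^ 2)) := by
    rw [e₁, e₂, e₃] at h3
    rw [← h3, ← integral_neg, ← integral_const_mul]
    refine integral_congr_ae (Eventually.of_forall fun z => ?_)
    dsimp only
    rcases eq_or_ne z 0 with rfl | hz
    · rw [hap, hη00]
      simp
    · rw [hap, ← neg_mul, hw.eq z hz, mul_assoc]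
  have h5 : c * ∫ z, a z ^ p ≤ M * ∫ z, a z := by
    rw [h4, ← integral_neg, ← integral_const_mul]
    have hint : Integrable fun z => w z * (η (‖z‖ ^ 2) ^ (m + 7) * B (‖z‖ ^ 2)) := by
      refine (integrable_mul_of_tsupport (f := fun z => w z * B (‖z‖ ^ 2)) (fun z hz => ?_)
        (hpow_smooth _).continuous (hcs (m + 6))).congr (Eventually.of_forall fun z => ?_)
      · exact (hw.contDiffAt z (hne _ z hz)).continuousAt.mul
          (hB.continuous.comp (continuous_norm.pow 2)).continuousAt
      · dsimp only
        ring
    refine integral_mono hint.neg (ha_int.const_mul M) fun z => ?_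
    dsimp only
    by_cases hz : 1 / 2 ≤ ‖z‖ ^ 2 ∧ ‖z‖ ^ 2 ≤ 9 / 2
    · have hB' := (abs_le.1 (hM _ hz)).1
      have hη01 : η (‖z‖ ^ 2) ^ 6 ≤ 1 := pow_le_one₀ η.nonneg η.le_one
      have hη6 : 0 ≤ η (‖z‖ ^ 2) ^ 6 := pow_nonneg η.nonneg _
      have := ha0 z
      have e : w z * (η (‖z‖ ^ 2) ^ (m + 7) * B (‖z‖ ^ 2)) =
          a z * (η (‖z‖ ^ 2) ^ 6 * B (‖z‖ ^ 2)) := by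
        rw [ha_def]
        ring
      rw [e, ← mul_neg, mul_comm M]
      refine mul_le_mul_of_nonneg_left ?_ this
      nlinarith
    · have h0 := hη0 _ hz
      simp [ha_def, h0]
  have h6 : (M + 1) * ∫ z, a z ≤ c * (∫ z, a z ^ p) / 2 + K * volume.real S := by
    have hK_int : Integrable (S.indicator fun _ => K) :=
      (integrable_indicator_iff Metric.isClosed_closedBall.measurableSet).2
        (integrableOn_const (isCompact_closedBall 0 3).measure_lt_top.ne)
    have e : K * volume.real S = ∫ z, S.indicator (fun _ => K) z := by
      rw [integral_indicator Metric.isClosed_closedBall.measurableSet,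
        setIntegral_const, smul_eq_mul, mul_comm]
    have e' : c * (∫ z, a z ^ p) / 2 = ∫ z, c * a z ^ p / 2 := by
      rw [integral_div, integral_const_mul]
    rw [e, e', ← integral_add ((hap_int.const_mul c).div_const 2) hK_int, ← integral_const_mul]
    refine integral_mono (ha_int.const_mul _) (((hap_int.const_mul c).div_const 2).add hK_int)
      fun z => ?_
    by_cases hz : z ∈ S
    · simpa [hz] using hY _ (ha0 z)
    · have : a z = 0 := by
        have : η (‖z‖ ^ 2) = 0 := by
          refine hη0 _ fun h => hz ?_
          rw [mem_closedBall_zero_iff]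
          nlinarith [h.2, norm_nonneg z]
        simp [ha_def, this]
      simp [hz, this, Real.zero_rpow (by linarith : p ≠ 0)]
  have h7 : ∫ z in {z | 1 ≤ ‖z‖ ∧ ‖z‖ ≤ 2}, w z ≤ ∫ z, a z := by
    have : ∫ z in {z | 1 ≤ ‖z‖ ∧ ‖z‖ ≤ 2}, w z = ∫ z in {z | 1 ≤ ‖z‖ ∧ ‖z‖ ≤ 2}, a z := by
      refine setIntegral_congr_fun (isCompact_annulus 1 2).measurableSet fun z hz => ?_
      simp only [ha_def]
      rw [hη1 _ (by nlinarith [hz.1]) (by nlinarith [hz.1, hz.2]), one_pow, mul_one]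
    rw [this]
    exact setIntegral_le_integral ha_int (Eventually.of_forall ha0)
  have h8 : 0 ≤ ∫ z, a z := integral_nonneg ha0
  nlinarith

theorem IsPuncturedSolution.exists_integral_annulus_le {n : ℕ} (hn : 7 ≤ n) {c : ℝ} (hc : 0 < c)
    {u : EuclideanSpace ℝ (Fin n) → ℝ} (hu : IsPuncturedSolution c u) :
    ∃ C, 0 ≤ C ∧ ∀ r, 0 < r →
      ∫ x in {x | r ≤ ‖x‖ ∧ ‖x‖ ≤ 2 * r}, u x ≤ C * r ^ (((n : ℝ) + 6) / 2) := by
  obtain ⟨C, hC, h⟩ := _root_.exists_integral_annulus_le hn hc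
  refine ⟨C, hC, fun r hr => ?_⟩
  have h1 := h _ (hu.rescale hn hr)
  rw [integral_const_mul, Measure.setIntegral_comp_smul_of_pos _ _ _ hr] at h1
  have hset : r • {z : EuclideanSpace ℝ (Fin n) | 1 ≤ ‖z‖ ∧ ‖z‖ ≤ 2} =
      {x | r ≤ ‖x‖ ∧ ‖x‖ ≤ 2 * r} := by
    ext x
    rw [Set.mem_smul_set_iff_inv_smul_mem₀ hr.ne']
    simp only [Set.mem_ofPred_eq, norm_smul, norm_inv, Real.norm_of_nonneg hr.le]
    rw [inv_mul_eq_div, le_div_iff₀ hr, div_le_iff₀ hr, one_mul]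
  rw [hset, finrank_euclideanSpace_fin, smul_eq_mul, ← mul_assoc] at h1
  have h2 : r ^ (((n : ℝ) - 6) / 2) * (r ^ n)⁻¹ = (r ^ (((n : ℝ) + 6) / 2))⁻¹ := by
    rw [← Real.rpow_natCast, ← Real.rpow_neg hr.le, ← Real.rpow_neg hr.le, ← Real.rpow_add hr]
    congr 1
    ring
  rwa [h2, inv_mul_le_iff₀ (by positivity), mul_comm _ C] at h1

theorem exists_smooth_radial_profile {n : ℕ} (hn : 7 ≤ n) {ρ : ℝ} (hρ : 0 < ρ) :
    ∃ g : ℝ → ℝ, ContDiff ℝ ∞ g ∧ (∀ s, 0 ≤ g s) ∧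
      (∀ s, ρ ≤ s → g s = s ^ (1 - (n : ℝ) / 2)) ∧
      (∀ s, 4 * s * deriv (deriv g) s + 2 * n * deriv g s ≤ 0) ∧
      (∀ s, ρ ≤ s → 4 * s * deriv (deriv g) s + 2 * n * deriv g s = 0) ∧
      ∃ s, 0 < s ∧ 4 * s * deriv (deriv g) s + 2 * n * deriv g s < 0 := by
  have hn' : (7 : ℝ) ≤ n := by exact_mod_cast hn
  set χ : ℝ → ℝ := fun s => Real.smoothTransition (2 * s / ρ - 1) with hχ_def
  have hχ : ContDiff ℝ ∞ χ := Real.smoothTransition.contDiff.comp (by fun_prop)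
  have hχ0 : ∀ s, s ≤ ρ / 2 → χ s = 0 := fun s hs => Real.smoothTransition.zero_of_nonpos (by
    rw [sub_nonpos, div_le_one hρ]
    linarith)
  have hχ1 : ∀ s, ρ ≤ s → χ s = 1 := fun s hs => Real.smoothTransition.one_of_one_le (by
    rw [le_sub_iff_add_le, le_div_iff₀ hρ]
    linarith)
  have hχ_mono : Monotone χ := fun s t hst => Real.smoothTransition.monotone (by gcongr)
  have hχ_nonneg : ∀ s, 0 ≤ χ s := fun s => Real.smoothTransition.nonneg _
  set h : ℝ → ℝ := fun s => s ^ (-(n : ℝ) / 2) * χ s with hh_def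
  have hh0 : ∀ s, s < ρ / 2 → h =ᶠ[𝓝 s] fun _ => 0 := by
    intro s hs
    filter_upwards [Iio_mem_nhds hs] with t ht
    simp [hh_def, hχ0 t (le_of_lt ht)]
  have hh : ContDiff ℝ ∞ h := by
    refine contDiff_iff_contDiffAt.2 fun s => ?_
    rcases lt_or_ge s (ρ / 2) with hs | hs
    · exact contDiffAt_const.congr_of_eventuallyEq (hh0 s hs)
    · exact (Real.contDiffAt_rpow_const_of_ne (by linarith)).mul hχ.contDiffAt
  have hh_nonneg : ∀ s, 0 ≤ h s := by
    intro s
    rcases lt_or_ge s (ρ / 2) with hs | hs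
    · exact (hh0 s hs).self_of_nhds.ge
    · exact mul_nonneg (Real.rpow_nonneg (by linarith) _) (hχ_nonneg s)
  set κ : ℝ := (n : ℝ) / 2 - 1 with hκ_def
  have hκ : 0 < κ := by rw [hκ_def]; linarith
  set g : ℝ → ℝ := fun s => ρ ^ (-κ) - κ * ∫ t in ρ..s, h t with hg_def
  have hgd : ∀ s, HasDerivAt g (-(κ * h s)) s := fun s => by
    simpa using ((hh.continuous.integral_hasStrictDerivAt ρ s).hasDerivAt.const_mul κ).const_sub
      (ρ ^ (-κ))
  have hg' : deriv g = fun s => -(κ * h s) := funext fun s => (hgd s).deriv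
  have hg : ContDiff ℝ ∞ g :=
    contDiff_infty_iff_deriv.2 ⟨fun s => (hgd s).differentiableAt, by rw [hg']; fun_prop⟩
  have hg'' : ∀ s, deriv (deriv g) s = -(κ * deriv h s) := fun s => by
    rw [hg']
    exact ((hh.differentiable (by simp) s).hasDerivAt.const_mul κ).neg.deriv
  have hg1 : ∀ s, ρ ≤ s → g s = s ^ (1 - (n : ℝ) / 2) := by
    intro s hs
    have e : ∫ t in ρ..s, h t = ∫ t in ρ..s, t ^ (-(n : ℝ) / 2) := by
      refine intervalIntegral.integral_congr fun t ht => ?_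
      rw [Set.uIcc_of_le hs] at ht
      simp [hh_def, hχ1 t ht.1]
    have hne : -(n : ℝ) / 2 ≠ -1 := by intro hc; linarith
    have h0 : (0 : ℝ) ∉ Set.uIcc ρ s := by
      rw [Set.uIcc_of_le hs]
      exact fun h => absurd h.1 (by linarith)
    simp only [hg_def]
    rw [e, integral_rpow (Or.inr ⟨hne, h0⟩), show -(n : ℝ) / 2 + 1 = -κ by rw [hκ_def]; ring,
      show 1 - (n : ℝ) / 2 = -κ by rw [hκ_def]; ring]
    field_simp
    ring
  have hLpos : ∀ s, 0 < s → 4 * s * deriv (deriv g) s + 2 * n * deriv g s =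
      -(4 * κ * s * s ^ (-(n : ℝ) / 2) * deriv χ s) := by
    intro s hs
    have h1 : HasDerivAt h (-(n : ℝ) / 2 * s ^ (-(n : ℝ) / 2 - 1) * χ s +
        s ^ (-(n : ℝ) / 2) * deriv χ s) s :=
      (Real.hasDerivAt_rpow_const (Or.inl hs.ne')).mul (hχ.differentiable (by simp) s).hasDerivAt
    rw [hg'', h1.deriv, hg', Real.rpow_sub_one hs.ne']
    simp only [hh_def]
    field_simp
    ring
  have hLneg : ∀ s, s < ρ / 2 → 4 * s * deriv (deriv g) s + 2 * n * deriv g s = 0 := by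
    intro s hs
    rw [hg'', hg', (hh0 s hs).deriv_eq]
    simp [(hh0 s hs).self_of_nhds]
  have hχ' : ∀ s, 0 ≤ deriv χ s := fun s => hχ_mono.deriv_nonneg
  refine ⟨g, hg, fun s => ?_, hg1, fun s => ?_, fun s hs => ?_, ?_⟩
  · have hanti : Antitone g := antitone_of_deriv_nonpos (fun s => (hgd s).differentiableAt)
      fun s => by
        rw [(hgd s).deriv]
        exact neg_nonpos.2 (mul_nonneg hκ.le (hh_nonneg s))
    refine le_trans ?_ (hanti (le_max_left s ρ))
    rw [hg1 _ (le_max_right _ _)]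
    exact Real.rpow_nonneg (hρ.le.trans (le_max_right _ _)) _
  · rcases lt_or_ge s (ρ / 2) with hs | hs
    · exact (hLneg s hs).le
    · have hs0 : 0 < s := by linarith
      rw [hLpos s hs0]
      have := hχ' s
      exact neg_nonpos.2 (by positivity)
  · have hs0 : 0 < s := by linarith
    have hmax : IsLocalMax χ s := Eventually.of_forall fun t => by
      rw [hχ1 s hs]
      exact Real.smoothTransition.le_one _
    rw [hLpos s hs0, hmax.deriv_eq_zero]
    simp
  · obtain ⟨s, hs, hs'⟩ := exists_deriv_eq_slope χ (show ρ / 2 < ρ by linarith)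
      hχ.continuous.continuousOn (hχ.differentiable (by simp)).differentiableOn
    have hs0 : 0 < s := by linarith [hs.1]
    refine ⟨s, hs0, ?_⟩
    rw [hLpos s hs0, hs', hχ0 _ le_rfl, hχ1 _ le_rfl]
    have : 0 < ρ - ρ / 2 := by linarith
    rw [neg_lt_zero]
    positivity

theorem exists_truncated_fundamental_solution {n : ℕ} (hn : 7 ≤ n) {σ : ℝ} (hσ : 0 < σ)
    (x₀ : EuclideanSpace ℝ (Fin n)) :
    ∃ Γ : EuclideanSpace ℝ (Fin n) → ℝ, ContDiff ℝ ∞ Γ ∧ (∀ x, 0 ≤ Γ x) ∧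
      (∀ x, σ ≤ ‖x - x₀‖ → Γ x = (‖x - x₀‖ ^ 2) ^ (1 - (n : ℝ) / 2)) ∧
      (∀ x, laplacian Γ x ≤ 0) ∧ (∀ x, σ ≤ ‖x - x₀‖ → laplacian Γ x = 0) ∧
      ∃ x, laplacian Γ x < 0 := by
  obtain ⟨g, hg, hg0, hg1, hL, hL0, s, hs, hLs⟩ :=
    exists_smooth_radial_profile hn (show 0 < σ ^ 2 by positivity)
  have e := laplacian_comp_norm_sub_sq (contDiff_infty.1 hg 2) x₀
  refine ⟨fun x => g (‖x - x₀‖ ^ 2), hg.comp ((contDiff_id.sub contDiff_const).norm_sq ℝ),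
    fun x => hg0 _, fun x hx => hg1 _ (by gcongr), fun x => ?_, fun x hx => ?_,
    x₀ + EuclideanSpace.single ⟨0, by omega⟩ (√s), ?_⟩
  · rw [e]
    exact hL _
  · rw [e]
    exact hL0 _ (by gcongr)
  · rw [e]
    simpa [Real.sq_sqrt hs.le] using hLs

theorem exists_laplacian_iterate_bound {n : ℕ} {Φ : ℝ → EuclideanSpace ℝ (Fin n) → ℝ}
    {K : Set (ℝ × EuclideanSpace ℝ (Fin n))} (hK : IsCompact K)
    (hΦ : ∀ p ∈ K, ContDiffAt ℝ ∞ (Function.uncurry Φ) p) :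
    ∃ M, ∀ p ∈ K, |laplacian (laplacian (laplacian (Φ p.1))) p.2| ≤ M := by
  refine hK.exists_bound_of_continuousOn
    (f := fun p => laplacian (laplacian (laplacian (Φ p.1))) p.2) fun p hp => ?_
  have h1 := (hΦ p hp).laplacian_param (m := ∞) le_rfl
  have h2 := h1.laplacian_param (m := ∞) le_rfl
  exact (h2.laplacian_param (m := ∞) le_rfl).continuousAt.continuousWithinAt

theorem laplacian_iterate_eventuallyEq {n : ℕ} {f g : EuclideanSpace ℝ (Fin n) → ℝ}
    {x : EuclideanSpace ℝ (Fin n)} (h : f =ᶠ[𝓝 x] g) :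
    laplacian (laplacian (laplacian f)) x = laplacian (laplacian (laplacian g)) x :=
  (laplacian_eventuallyEq (laplacian_eventuallyEq (laplacian_eventuallyEq h))).self_of_nhds

/-- A smooth cutoff: `1` on `(-∞, 1]` and `0` on `[4, ∞)`. -/
def radialCutoff (s : ℝ) : ℝ := Real.smoothTransition ((4 - s) / 3)

theorem contDiff_radialCutoff : ContDiff ℝ ∞ radialCutoff :=
  Real.smoothTransition.contDiff.comp (by fun_prop)

theorem radialCutoff_eq_one {s : ℝ} (hs : s ≤ 1) : radialCutoff s = 1 :=
  Real.smoothTransition.one_of_one_le (by linarith)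

theorem radialCutoff_eq_zero {s : ℝ} (hs : 4 ≤ s) : radialCutoff s = 0 :=
  Real.smoothTransition.zero_of_nonpos (by linarith)

theorem radialCutoff_antitone : Antitone radialCutoff :=
  fun _ _ h => Real.smoothTransition.monotone (by linarith)

theorem exists_laplacian_iterate_inner_bound {n : ℕ} {Γ : EuclideanSpace ℝ (Fin n) → ℝ}
    (hΓ : ContDiff ℝ ∞ Γ) :
    ∃ M, 0 ≤ M ∧ ∀ t, 0 < t → t ≤ 1 → ∀ x, t ≤ ‖x‖ → ‖x‖ ≤ 2 * t →
      |laplacian (laplacian (laplacian fun y => Γ y * (1 - radialCutoff (‖t⁻¹ • y‖ ^ 2)))) x| ≤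
        M * (t⁻¹) ^ 6 := by
  have hc := contDiff_radialCutoff
  let Φ : ℝ → EuclideanSpace ℝ (Fin n) → ℝ :=
    fun t z => Γ (t • z) * (1 - radialCutoff (‖z‖ ^ 2))
  obtain ⟨M, hM⟩ := exists_laplacian_iterate_bound (Φ := Φ)
    ((isCompact_Icc (a := (0 : ℝ)) (b := 1)).prod (isCompact_annulus (n := n) 1 2)) fun p _ => by
      have h1 : ContDiff ℝ ∞ fun q : ℝ × EuclideanSpace ℝ (Fin n) => Γ (q.1 • q.2) :=
        hΓ.comp (contDiff_fst.smul contDiff_snd)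
      have h2 : ContDiff ℝ ∞ fun q : ℝ × EuclideanSpace ℝ (Fin n) => radialCutoff (‖q.2‖ ^ 2) :=
        hc.comp (contDiff_snd.norm_sq ℝ)
      exact (h1.mul (contDiff_const.sub h2)).contDiffAt
  refine ⟨|M|, abs_nonneg M, fun t ht ht1 x hx1 hx2 => ?_⟩
  have e : (fun y => Γ y * (1 - radialCutoff (‖t⁻¹ • y‖ ^ 2))) =
      fun y => 1 * Φ t (t⁻¹ • y) := by
    ext y
    simp [Φ, smul_smul, mul_inv_cancel₀ ht.ne']
  rw [e]
  simp only [laplacian_const_mul_comp_smul]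
  rw [abs_mul, mul_comm]
  have hx : ‖t⁻¹ • x‖ = ‖x‖ / t := by
    rw [norm_smul, norm_inv, Real.norm_of_nonneg ht.le, inv_mul_eq_div]
  have := hM (t, t⁻¹ • x) ⟨⟨ht.le, ht1⟩, by
    change 1 ≤ ‖t⁻¹ • x‖ ∧ ‖t⁻¹ • x‖ ≤ 2
    rw [hx, le_div_iff₀ ht, div_le_iff₀ ht, one_mul]
    exact ⟨hx1, hx2⟩⟩
  rw [show 1 * t⁻¹ ^ 2 * t⁻¹ ^ 2 * t⁻¹ ^ 2 = t⁻¹ ^ 6 by ring,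
    abs_of_pos (a := t⁻¹ ^ 6) (by positivity)]
  exact mul_le_mul_of_nonneg_right (this.trans (le_abs_self M)) (by positivity)

theorem exists_laplacian_iterate_outer_bound {n : ℕ} (hn : 7 ≤ n)
    {Γ : EuclideanSpace ℝ (Fin n) → ℝ} {x₀ : EuclideanSpace ℝ (Fin n)} {σ : ℝ}
    (hσ : σ < ‖x₀‖) (hx₀ : x₀ ≠ 0)
    (hΓ : ∀ x, σ ≤ ‖x - x₀‖ → Γ x = (‖x - x₀‖ ^ 2) ^ (1 - (n : ℝ) / 2)) :
    ∃ M, 0 ≤ M ∧ ∀ t, 0 < t → t * ‖x₀‖ ≤ 1 / 2 → ∀ x, t⁻¹ ≤ ‖x‖ → ‖x‖ ≤ 2 * t⁻¹ →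
      |laplacian (laplacian (laplacian fun y => Γ y * radialCutoff (‖t • y‖ ^ 2))) x| ≤
        M * t ^ (n + 4) := by
  have hc := contDiff_radialCutoff
  have hx₀' : 0 < ‖x₀‖ := norm_pos_iff.2 hx₀
  let Φ : ℝ → EuclideanSpace ℝ (Fin n) → ℝ :=
    fun t z => (‖z - t • x₀‖ ^ 2) ^ (1 - (n : ℝ) / 2) * radialCutoff (‖z‖ ^ 2)
  obtain ⟨M, hM⟩ := exists_laplacian_iterate_bound (Φ := Φ)
    ((isCompact_Icc (a := (0 : ℝ)) (b := (2 * ‖x₀‖)⁻¹)).prod (isCompact_annulus (n := n) 1 2))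
    fun p hp => by
      have hne : ‖p.2 - p.1 • x₀‖ ^ 2 ≠ 0 := by
        have h1 : ‖p.1 • x₀‖ ≤ 1 / 2 := by
          rw [norm_smul, Real.norm_of_nonneg hp.1.1]
          calc p.1 * ‖x₀‖ ≤ (2 * ‖x₀‖)⁻¹ * ‖x₀‖ := by gcongr; exact hp.1.2
            _ = 1 / 2 := by field_simp
        have h2 := norm_sub_norm_le p.2 (p.1 • x₀)
        have h3 : 1 ≤ ‖p.2‖ := hp.2.1
        have : 0 < ‖p.2 - p.1 • x₀‖ := by linarith
        positivity
      have h1 : ContDiff ℝ ∞ fun q : ℝ × EuclideanSpace ℝ (Fin n) => ‖q.2 - q.1 • x₀‖ ^ 2 :=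
        (contDiff_snd.sub (contDiff_fst.smul contDiff_const)).norm_sq ℝ
      have h2 : ContDiff ℝ ∞ fun q : ℝ × EuclideanSpace ℝ (Fin n) => radialCutoff (‖q.2‖ ^ 2) :=
        hc.comp (contDiff_snd.norm_sq ℝ)
      exact (h1.contDiffAt.rpow_const_of_ne hne).mul h2.contDiffAt
  refine ⟨|M|, abs_nonneg M, fun t ht ht1 x hx1 hx2 => ?_⟩
  have ht2 : 2 * ‖x₀‖ ≤ t⁻¹ := by
    rw [le_inv_comm₀ (by positivity) ht, ← one_div, le_div_iff₀ (by positivity)]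
    linarith
  have e : (fun y => Γ y * radialCutoff (‖t • y‖ ^ 2)) =ᶠ[𝓝 x]
      fun y => t ^ (n - 2) * Φ t (t • y) := by
    have hmem : ∀ᶠ y in 𝓝 x, σ < ‖y - x₀‖ := by
      refine (by fun_prop : Continuous fun y : EuclideanSpace ℝ (Fin n) =>
        ‖y - x₀‖).continuousAt.eventually (lt_mem_nhds ?_)
      have := norm_sub_norm_le x x₀
      linarith
    filter_upwards [hmem] with y hy
    rw [hΓ y hy.le]
    simp only [Φ]
    rw [← smul_sub, norm_smul t (y - x₀), Real.norm_of_nonneg ht.le, mul_pow,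
      Real.mul_rpow (by positivity) (by positivity), ← mul_assoc, ← mul_assoc]
    have : t ^ (n - 2) * (t ^ 2) ^ (1 - (n : ℝ) / 2) = 1 := by
      rw [← Real.rpow_natCast, ← Real.rpow_natCast t 2, ← Real.rpow_mul ht.le,
        ← Real.rpow_add ht, Nat.cast_sub (by omega)]
      convert Real.rpow_zero t using 2
      push_cast
      ring
    rw [this, one_mul]
  rw [laplacian_iterate_eventuallyEq e]
  simp only [laplacian_const_mul_comp_smul]
  rw [abs_mul, mul_comm]
  have hx : ‖t • x‖ = t * ‖x‖ := by rw [norm_smul, Real.norm_of_nonneg ht.le]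
  have := hM (t, t • x) ⟨⟨ht.le, by
      rwa [le_inv_comm₀ ht (by positivity)]⟩, by
    change 1 ≤ ‖t • x‖ ∧ ‖t • x‖ ≤ 2
    rw [hx]
    constructor
    · rwa [inv_le_iff_one_le_mul₀' ht] at hx1
    · rwa [← div_eq_mul_inv, le_div_iff₀' ht] at hx2⟩
  rw [show t ^ (n - 2) * t ^ 2 * t ^ 2 * t ^ 2 = t ^ (n + 4) by
    rw [← pow_add, ← pow_add, ← pow_add]; congr 1; omega,
    abs_of_pos (a := t ^ (n + 4)) (by positivity)]
  exact mul_le_mul_of_nonneg_right (this.trans (le_abs_self M)) (by positivity)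

theorem radialCutoff_smul_eq_one {n : ℕ} {t : ℝ} {x : EuclideanSpace ℝ (Fin n)} (ht : 0 < t)
    (hx : ‖x‖ ≤ t⁻¹) : radialCutoff (‖t • x‖ ^ 2) = 1 := by
  refine radialCutoff_eq_one (pow_le_one₀ (norm_nonneg _) ?_)
  rw [norm_smul, Real.norm_of_nonneg ht.le]
  exact (mul_le_mul_of_nonneg_left hx ht.le).trans_eq (mul_inv_cancel₀ ht.ne')

theorem radialCutoff_smul_eq_zero {n : ℕ} {t : ℝ} {x : EuclideanSpace ℝ (Fin n)} (ht : 0 < t)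
    (hx : 2 * t⁻¹ ≤ ‖x‖) : radialCutoff (‖t • x‖ ^ 2) = 0 := by
  refine radialCutoff_eq_zero ?_
  have h : 2 ≤ ‖t • x‖ := by
    rw [norm_smul, Real.norm_of_nonneg ht.le]
    calc 2 = t * (2 * t⁻¹) := by field_simp
      _ ≤ t * ‖x‖ := by gcongr
  nlinarith

/-- The factor that cuts a function off near the origin and near infinity. -/
def annularCutoff {n : ℕ} (t : ℝ) (x : EuclideanSpace ℝ (Fin n)) : ℝ :=
  radialCutoff (‖t • x‖ ^ 2) - radialCutoff (‖t⁻¹ • x‖ ^ 2)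

theorem contDiff_annularCutoff {n : ℕ} (t : ℝ) :
    ContDiff ℝ ∞ (annularCutoff t : EuclideanSpace ℝ (Fin n) → ℝ) :=
  (contDiff_radialCutoff.comp ((contDiff_id.const_smul t).norm_sq ℝ)).sub
    (contDiff_radialCutoff.comp ((contDiff_id.const_smul t⁻¹).norm_sq ℝ))

section AnnularCutoff

variable {n : ℕ} {t : ℝ} {x : EuclideanSpace ℝ (Fin n)}

theorem annularCutoff_eq_zero_of_norm_le (ht : 0 < t) (ht1 : t ≤ 1) (hx : ‖x‖ ≤ t) :
    annularCutoff t x = 0 := by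
  rw [annularCutoff, radialCutoff_smul_eq_one ht (hx.trans (ht1.trans (one_le_inv₀ ht |>.2 ht1))),
    radialCutoff_smul_eq_one (inv_pos.2 ht) (by rwa [inv_inv]), sub_self]

theorem annularCutoff_eq_zero_of_le_norm (ht : 0 < t) (ht1 : t ≤ 1) (hx : 2 * t⁻¹ ≤ ‖x‖) :
    annularCutoff t x = 0 := by
  have h := one_le_inv₀ ht |>.2 ht1
  rw [annularCutoff, radialCutoff_smul_eq_zero ht hx,
    radialCutoff_smul_eq_zero (inv_pos.2 ht) (by rw [inv_inv]; linarith), sub_self]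

theorem annularCutoff_of_norm_le (ht : 0 < t) (hx : ‖x‖ ≤ t⁻¹) :
    annularCutoff t x = 1 - radialCutoff (‖t⁻¹ • x‖ ^ 2) := by
  rw [annularCutoff, radialCutoff_smul_eq_one ht hx]

theorem annularCutoff_of_le_norm (ht : 0 < t) (hx : 2 * t ≤ ‖x‖) :
    annularCutoff t x = radialCutoff (‖t • x‖ ^ 2) := by
  rw [annularCutoff, radialCutoff_smul_eq_zero (inv_pos.2 ht) (by rwa [inv_inv]), sub_zero]

theorem annularCutoff_nonneg (ht : 0 < t) (ht1 : t ≤ 1) : 0 ≤ annularCutoff t x := by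
  refine sub_nonneg.2 (radialCutoff_antitone ?_)
  rw [norm_smul, norm_smul, norm_inv, Real.norm_of_nonneg ht.le]
  have := ht1.trans (one_le_inv₀ ht |>.2 ht1)
  gcongr

theorem hasCompactSupport_mul_annularCutoff (ht : 0 < t) (ht1 : t ≤ 1)
    (Γ : EuclideanSpace ℝ (Fin n) → ℝ) :
    HasCompactSupport fun x => Γ x * annularCutoff t x := by
  refine HasCompactSupport.of_support_subset_isCompact (isCompact_annulus t (2 * t⁻¹)) fun x hx => ?_
  by_contra h
  refine hx ?_
  rcases lt_or_ge ‖x‖ t with h1 | h1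
  · simp [annularCutoff_eq_zero_of_norm_le ht ht1 h1.le]
  · simp [annularCutoff_eq_zero_of_le_norm ht ht1 (le_of_not_ge fun h2 => h ⟨h1, h2⟩)]

theorem zero_notMem_tsupport_mul_annularCutoff (ht : 0 < t) (ht1 : t ≤ 1)
    (Γ : EuclideanSpace ℝ (Fin n) → ℝ) :
    (0 : EuclideanSpace ℝ (Fin n)) ∉ tsupport fun x => Γ x * annularCutoff t x := by
  rw [notMem_tsupport_iff_eventuallyEq]
  filter_upwards [Metric.ball_mem_nhds 0 ht] with x hx
  simp [annularCutoff_eq_zero_of_norm_le ht ht1 (mem_ball_zero_iff.1 hx).le]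

end AnnularCutoff

theorem laplacian_iterate_eq_zero {n : ℕ} {f : EuclideanSpace ℝ (Fin n) → ℝ}
    {x : EuclideanSpace ℝ (Fin n)} (h : laplacian f =ᶠ[𝓝 x] fun _ => 0) :
    laplacian (laplacian (laplacian f)) x = 0 := by
  have := (laplacian_eventuallyEq (laplacian_eventuallyEq h)).self_of_nhds
  simpa using this

theorem exists_laplacian_iterate_mul_annularCutoff_bound {n : ℕ} (hn : 7 ≤ n)
    {Γ : EuclideanSpace ℝ (Fin n) → ℝ} {x₀ : EuclideanSpace ℝ (Fin n)} {σ : ℝ}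
    (hx₀ : x₀ ≠ 0) (hσ : 2 * σ ≤ ‖x₀‖) (hΓ : ContDiff ℝ ∞ Γ)
    (hΓ1 : ∀ x, σ ≤ ‖x - x₀‖ → Γ x = (‖x - x₀‖ ^ 2) ^ (1 - (n : ℝ) / 2))
    (hΓ2 : ∀ x, σ ≤ ‖x - x₀‖ → laplacian Γ x = 0) :
    ∃ M, 0 ≤ M ∧ ∀ t, 0 < t → t ≤ 1 / 2 → t * ‖x₀‖ ≤ 1 / 2 → 4 * t < ‖x₀‖ → ∀ x,
      |laplacian (laplacian (laplacian Γ)) x -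
        laplacian (laplacian (laplacian fun y => Γ y * annularCutoff t y)) x| ≤
      {x | t ≤ ‖x‖ ∧ ‖x‖ ≤ 2 * t}.indicator (fun _ => M * t⁻¹ ^ 6) x +
        {x | t⁻¹ ≤ ‖x‖ ∧ ‖x‖ ≤ 2 * t⁻¹}.indicator (fun _ => M * t ^ (n + 4)) x := by
  have hx₀' : 0 < ‖x₀‖ := norm_pos_iff.2 hx₀
  obtain ⟨M₁, hM₁, h₁⟩ := exists_laplacian_iterate_inner_bound hΓ
  obtain ⟨M₂, hM₂, h₂⟩ :=
    exists_laplacian_iterate_outer_bound hn (show σ < ‖x₀‖ by linarith) hx₀ hΓ1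
  refine ⟨max M₁ M₂, hM₁.trans (le_max_left _ _), fun t ht ht1 ht2 ht3 x => ?_⟩
  set M := max M₁ M₂
  have hM : 0 ≤ M := hM₁.trans (le_max_left _ _)
  have hinv : 2 ≤ t⁻¹ := by rwa [le_inv_comm₀ two_pos ht, ← one_div]
  have hinv2 : 2 * ‖x₀‖ ≤ t⁻¹ := by
    rw [le_inv_comm₀ (by positivity) ht, ← one_div, le_div_iff₀ (by positivity)]
    linarith
  have hlt : ∀ r, ‖x‖ < r → ∀ᶠ y in 𝓝 x, ‖y‖ < r := fun r hr =>
    continuous_norm.continuousAt.eventually (gt_mem_nhds hr)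
  have hgt : ∀ r, r < ‖x‖ → ∀ᶠ y in 𝓝 x, r < ‖y‖ := fun r hr =>
    continuous_norm.continuousAt.eventually (lt_mem_nhds hr)
  have hnn1 : 0 ≤ {x : EuclideanSpace ℝ (Fin n) | t ≤ ‖x‖ ∧ ‖x‖ ≤ 2 * t}.indicator
      (fun _ => M * t⁻¹ ^ 6) x := Set.indicator_nonneg (fun _ _ => by positivity) x
  have hnn2 : 0 ≤ {x : EuclideanSpace ℝ (Fin n) | t⁻¹ ≤ ‖x‖ ∧ ‖x‖ ≤ 2 * t⁻¹}.indicator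
      (fun _ => M * t ^ (n + 4)) x := Set.indicator_nonneg (fun _ _ => by positivity) x
  have hΓ3 : σ < ‖x - x₀‖ → laplacian (laplacian (laplacian Γ)) x = 0 := fun h =>
    laplacian_iterate_eq_zero <| by
      filter_upwards [(continuous_id.sub continuous_const).norm.continuousAt.eventually
        (lt_mem_nhds h)] with y hy
      exact hΓ2 y hy.le
  have hnear : ‖x‖ ≤ 2 * t → σ < ‖x - x₀‖ := fun h => by
    have := norm_sub_norm_le x₀ x
    rw [norm_sub_rev] at this
    linarith
  have hfar : t⁻¹ ≤ ‖x‖ → σ < ‖x - x₀‖ := fun h => by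
    have := norm_sub_norm_le x x₀
    linarith
  have hzero : (∀ᶠ y in 𝓝 x, annularCutoff t y = 0) →
      laplacian (laplacian (laplacian fun y => Γ y * annularCutoff t y)) x = 0 := fun h => by
    rw [laplacian_iterate_eventuallyEq (g := fun _ => 0) (h.mono fun y hy => by simp [hy])]
    simp
  rcases lt_or_ge ‖x‖ t with hx1 | hx1
  · rw [hΓ3 (hnear (by linarith)), hzero ((hlt t hx1).mono fun y hy =>
      annularCutoff_eq_zero_of_norm_le ht (by linarith) hy.le), sub_zero, abs_zero]
    positivity
  rcases le_or_gt ‖x‖ (2 * t) with hx2 | hx2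
  · rw [hΓ3 (hnear hx2), zero_sub, abs_neg, laplacian_iterate_eventuallyEq
      (g := fun y => Γ y * (1 - radialCutoff (‖t⁻¹ • y‖ ^ 2)))
      ((hlt t⁻¹ (by linarith)).mono fun y hy => by simp only [annularCutoff_of_norm_le ht hy.le]),
      Set.indicator_of_mem (s := {x | t ≤ ‖x‖ ∧ ‖x‖ ≤ 2 * t}) ⟨hx1, hx2⟩]
    refine le_add_of_le_of_nonneg ((h₁ t ht (by linarith) x hx1 hx2).trans ?_) hnn2
    gcongr
    exact le_max_left _ _
  rcases lt_or_ge ‖x‖ t⁻¹ with hx3 | hx3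
  · rw [laplacian_iterate_eventuallyEq (f := fun y => Γ y * annularCutoff t y) (g := Γ), sub_self,
      abs_zero]
    · positivity
    · filter_upwards [hlt _ hx3, hgt _ hx2] with y hy1 hy2
      rw [annularCutoff_of_le_norm ht hy2.le, radialCutoff_smul_eq_one ht hy1.le, mul_one]
  rcases le_or_gt ‖x‖ (2 * t⁻¹) with hx4 | hx4
  · rw [hΓ3 (hfar hx3), zero_sub, abs_neg, laplacian_iterate_eventuallyEq
      (g := fun y => Γ y * radialCutoff (‖t • y‖ ^ 2))
      ((hgt (2 * t) hx2).mono fun y hy => by simp only [annularCutoff_of_le_norm ht hy.le]),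
      Set.indicator_of_mem (s := {x | t⁻¹ ≤ ‖x‖ ∧ ‖x‖ ≤ 2 * t⁻¹}) ⟨hx3, hx4⟩]
    refine le_add_of_nonneg_of_le hnn1 ((h₂ t ht ht2 x hx3 hx4).trans ?_)
    gcongr
    exact le_max_right _ _
  · rw [hΓ3 (hfar hx3), hzero ((hgt _ hx4).mono fun y hy =>
      annularCutoff_eq_zero_of_le_norm ht (by linarith) hy.le), sub_zero, abs_zero]
    positivity

theorem IsPuncturedSolution.integral_mul_laplacian_iterate_nonpos {n : ℕ} {c : ℝ}
    (hc : 0 < c) {u : EuclideanSpace ℝ (Fin n) → ℝ} (hu : IsPuncturedSolution c u)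
    {φ : EuclideanSpace ℝ (Fin n) → ℝ} (hφ : ContDiff ℝ ∞ φ) (hφc : HasCompactSupport φ)
    (hφ0 : (0 : EuclideanSpace ℝ (Fin n)) ∉ tsupport φ) (hφ_nonneg : ∀ x, 0 ≤ φ x) :
    ∫ x, u x * laplacian (laplacian (laplacian φ)) x ≤ 0 := by
  rw [← integral_laplacian_iterate_mul hu.contDiffAt hφ hφc hφ0]
  refine integral_nonpos fun x => ?_
  by_cases hx : x = 0
  · simp [hx, image_eq_zero_of_notMem_tsupport hφ0]
  · refine mul_nonpos_of_nonpos_of_nonneg ?_ (hφ_nonneg x)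
    have h1 := hu.eq x hx
    have h2 := hu.pos x hx
    have : 0 < c * u x ^ (((n : ℝ) + 6) / ((n : ℝ) - 6)) := by positivity
    linarith

theorem IsPuncturedSolution.integrableOn_annulus {n : ℕ} {c : ℝ}
    {u : EuclideanSpace ℝ (Fin n) → ℝ} (hu : IsPuncturedSolution c u) {r : ℝ} (hr : 0 < r) (R : ℝ) :
    IntegrableOn u {x | r ≤ ‖x‖ ∧ ‖x‖ ≤ R} :=
  ContinuousOn.integrableOn_compact (isCompact_annulus r R) fun x hx =>
    (hu.contDiffAt x (norm_pos_iff.1 (hr.trans_le hx.1))).continuousAt.continuousWithinAt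

theorem IsPuncturedSolution.integral_mul_laplacian_iterate_fundamental_nonpos {n : ℕ}
    (hn : 7 ≤ n) {c : ℝ} (hc : 0 < c) {u : EuclideanSpace ℝ (Fin n) → ℝ}
    (hu : IsPuncturedSolution c u) {Γ : EuclideanSpace ℝ (Fin n) → ℝ}
    {x₀ : EuclideanSpace ℝ (Fin n)} {σ : ℝ} (hx₀ : x₀ ≠ 0) (hσ : 2 * σ ≤ ‖x₀‖)
    (hΓ : ContDiff ℝ ∞ Γ) (hΓ0 : ∀ x, 0 ≤ Γ x)
    (hΓ1 : ∀ x, σ ≤ ‖x - x₀‖ → Γ x = (‖x - x₀‖ ^ 2) ^ (1 - (n : ℝ) / 2))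
    (hΓ2 : ∀ x, σ ≤ ‖x - x₀‖ → laplacian Γ x = 0)
    (hint : Integrable fun x => u x * laplacian (laplacian (laplacian Γ)) x) :
    ∫ x, u x * laplacian (laplacian (laplacian Γ)) x ≤ 0 := by
  have hn' : (7 : ℝ) ≤ n := by exact_mod_cast hn
  have hx₀' : 0 < ‖x₀‖ := norm_pos_iff.2 hx₀
  obtain ⟨C, hC, hCu⟩ := hu.exists_integral_annulus_le hn hc
  obtain ⟨M, hM, hbound⟩ :=
    exists_laplacian_iterate_mul_annularCutoff_bound hn hx₀ hσ hΓ hΓ1 hΓ2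
  have hlim : Tendsto (fun t : ℝ => M * C * t ^ (((n : ℝ) - 6) / 2) +
      M * C * t ^ (((n : ℝ) + 2) / 2)) (𝓝[>] 0) (𝓝 0) := by
    have h : ∀ a : ℝ, 0 < a → Tendsto (fun t : ℝ => M * C * t ^ a) (𝓝[>] 0) (𝓝 0) := by
      intro a ha
      have := ((Real.continuousAt_rpow_const 0 a (Or.inr ha.le)).tendsto.const_mul (M * C)).mono_left
        (nhdsWithin_le_nhds (s := Set.Ioi 0))
      rwa [Real.zero_rpow ha.ne', mul_zero] at this
    simpa using (h _ (by linarith)).add (h _ (by linarith))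
  refine ge_of_tendsto hlim ?_
  have hsmall : ∀ b : ℝ, 0 < b → ∀ᶠ t in 𝓝[>] (0 : ℝ), t ≤ b := fun b hb =>
    nhdsWithin_le_nhds (Iic_mem_nhds hb)
  filter_upwards [self_mem_nhdsWithin, hsmall (1 / 2) (by positivity),
    hsmall (1 / (2 * ‖x₀‖)) (by positivity), hsmall (‖x₀‖ / 8) (by positivity)]
    with t ht ht1 ht2 ht3
  replace ht : 0 < t := ht
  have htx₀ : t * ‖x₀‖ ≤ 1 / 2 := by
    rw [le_div_iff₀ (by positivity)] at ht2
    linarith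
  specialize hbound t ht ht1 htx₀ (by linarith)
  set φ : EuclideanSpace ℝ (Fin n) → ℝ := fun y => Γ y * annularCutoff t y
  have ht1' : t ≤ 1 := by linarith
  have hφ : ContDiff ℝ ∞ φ := hΓ.mul (contDiff_annularCutoff t)
  have hφc : HasCompactSupport φ := hasCompactSupport_mul_annularCutoff ht ht1' Γ
  have hφ0 : (0 : EuclideanSpace ℝ (Fin n)) ∉ tsupport φ :=
    zero_notMem_tsupport_mul_annularCutoff ht ht1' Γ
  have hφu := hu.integral_mul_laplacian_iterate_nonpos hc hφ hφc hφ0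
    fun x => mul_nonneg (hΓ0 x) (annularCutoff_nonneg ht ht1')
  have hsub : tsupport (laplacian (laplacian (laplacian φ))) ⊆ tsupport φ :=
    ((tsupport_laplacian_subset _).trans (tsupport_laplacian_subset _)).trans
      (tsupport_laplacian_subset _)
  have hφint : Integrable fun x => u x * laplacian (laplacian (laplacian φ)) x :=
    integrable_mul_of_tsupport
      (fun x hx => (hu.contDiffAt x fun h => hφ0 (h ▸ hsub hx)).continuousAt)
      hφ.laplacian.laplacian.laplacian.continuous hφc.laplacian.laplacian.laplacian
  set A₁ : Set (EuclideanSpace ℝ (Fin n)) := {x | t ≤ ‖x‖ ∧ ‖x‖ ≤ 2 * t} with hA₁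
  set A₂ : Set (EuclideanSpace ℝ (Fin n)) := {x | t⁻¹ ≤ ‖x‖ ∧ ‖x‖ ≤ 2 * t⁻¹} with hA₂
  have hA₁m : MeasurableSet A₁ := (isCompact_annulus t (2 * t)).measurableSet
  have hA₂m : MeasurableSet A₂ := (isCompact_annulus t⁻¹ (2 * t⁻¹)).measurableSet
  have ht' : 0 < t⁻¹ := inv_pos.2 ht
  have hI₁ : Integrable (A₁.indicator fun x => M * t⁻¹ ^ 6 * u x) :=
    (integrable_indicator_iff hA₁m).2 ((hu.integrableOn_annulus ht _).const_mul _)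
  have hI₂ : Integrable (A₂.indicator fun x => M * t ^ (n + 4) * u x) :=
    (integrable_indicator_iff hA₂m).2 ((hu.integrableOn_annulus ht' _).const_mul _)
  have hpt : ∀ x, u x * laplacian (laplacian (laplacian Γ)) x -
      u x * laplacian (laplacian (laplacian φ)) x ≤
      A₁.indicator (fun x => M * t⁻¹ ^ 6 * u x) x +
        A₂.indicator (fun x => M * t ^ (n + 4) * u x) x := by
    intro x
    rw [← mul_sub]
    by_cases hx : x = 0
    · have h := hbound x
      have h1 : x ∉ A₁ := fun h => by simp [hA₁, hx, ht.not_ge] at h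
      have h2 : x ∉ A₂ := fun h => by simp [hA₂, hx, ht.not_ge] at h
      simp only [Set.indicator_of_notMem h1, Set.indicator_of_notMem h2, add_zero] at h ⊢
      rw [abs_nonpos_iff.1 h, mul_zero]
    · have h1 := mul_le_mul_of_nonneg_left ((le_abs_self _).trans (hbound x)) (hu.pos x hx).le
      rwa [mul_add, ← Set.indicator_mul_right A₁ u (fun _ => M * t⁻¹ ^ 6),
        ← Set.indicator_mul_right A₂ u (fun _ => M * t ^ (n + 4)),
        funext fun x => mul_comm (u x) (M * t⁻¹ ^ 6),
        funext fun x => mul_comm (u x) (M * t ^ (n + 4))] at h1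
  have hmono := integral_mono (hint.sub hφint) (hI₁.add hI₂) hpt
  simp only [Pi.sub_apply, Pi.add_apply] at hmono
  rw [integral_sub hint hφint, integral_add hI₁ hI₂, integral_indicator hA₁m,
    integral_indicator hA₂m, integral_const_mul, integral_const_mul] at hmono
  have h₁ : M * t⁻¹ ^ 6 * ∫ x in A₁, u x ≤ M * C * t ^ (((n : ℝ) - 6) / 2) := by
    refine (mul_le_mul_of_nonneg_left (hCu t ht) (by positivity)).trans_eq ?_
    rw [show ((n : ℝ) + 6) / 2 = ((n : ℝ) - 6) / 2 + (6 : ℕ) by push_cast; ring,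
      Real.rpow_add ht, Real.rpow_natCast]
    field_simp
  have h₂ : M * t ^ (n + 4) * ∫ x in A₂, u x ≤ M * C * t ^ (((n : ℝ) + 2) / 2) := by
    refine (mul_le_mul_of_nonneg_left (hCu t⁻¹ ht') (by positivity)).trans_eq ?_
    rw [Real.inv_rpow ht.le, ← Real.rpow_neg ht.le,
      show ((n : ℝ) + 2) / 2 = ((n + 4 : ℕ) : ℝ) + -(((n : ℝ) + 6) / 2) by push_cast; ring,
      Real.rpow_add ht, Real.rpow_natCast]
    ring
  linarith

theorem superharmonicity_of_laplacian_of_singular_solutions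
    (n : ℕ) (hn : 7 ≤ n)
    (u : EuclideanSpace ℝ (Fin n) → ℝ)
    (hpos : ∀ x : EuclideanSpace ℝ (Fin n), x ≠ 0 → 0 < u x)
    (hreg : ContDiffOn ℝ 6 u {x : EuclideanSpace ℝ (Fin n) | x ≠ 0})
    (hpde : ∀ x : EuclideanSpace ℝ (Fin n), x ≠ 0 →
      -(laplacian (laplacian (laplacian u)) x) = cN n * u x ^ (((n : ℝ) + 6) / ((n : ℝ) - 6)))
    (hsing : ∀ M : ℝ, ∀ ε : ℝ, 0 < ε → ∃ x : EuclideanSpace ℝ (Fin n),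
      x ≠ 0 ∧ ‖x‖ < ε ∧ M < u x) :
    ∀ x : EuclideanSpace ℝ (Fin n), x ≠ 0 → 0 ≤ laplacian (laplacian u) x := by
  have hu : IsPuncturedSolution (cN n) u :=
    ⟨hpos, fun x hx => hreg.contDiffAt (isOpen_ne.mem_nhds hx), hpde⟩
  have hu4 : ∀ x, x ≠ 0 → ContDiffAt ℝ 4 (laplacian u) x :=
    fun x hx => (hu.contDiffAt x hx).laplacian (by norm_num)
  have hu2 : ∀ x, x ≠ 0 → ContDiffAt ℝ 2 (laplacian (laplacian u)) x :=
    fun x hx => (hu4 x hx).laplacian (by norm_num)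
  intro x₀ hx₀
  by_contra! hneg
  obtain ⟨δ, hδ, hball⟩ := Metric.eventually_nhds_iff_ball.1
    ((hu2 x₀ hx₀).continuousAt.eventually (gt_mem_nhds hneg))
  have hx₀' : 0 < ‖x₀‖ := norm_pos_iff.2 hx₀
  obtain ⟨σ, hσ, hσ'⟩ := exists_between (lt_min hδ (half_pos hx₀'))
  obtain ⟨hσδ, hσx₀⟩ := lt_min_iff.1 hσ'
  obtain ⟨Γ, hΓ, hΓ0, hΓ1, hΓL, hΓ2, y, hy⟩ := exists_truncated_fundamental_solution hn hσ x₀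
  have hsupp : tsupport (laplacian Γ) ⊆ Metric.closedBall x₀ σ := by
    refine closure_minimal (fun x hx => ?_) Metric.isClosed_closedBall
    by_contra h
    rw [mem_closedBall_iff_norm, not_le] at h
    exact hx (hΓ2 x h.le)
  have hne : ∀ x ∈ tsupport (laplacian Γ), x ≠ 0 := by
    rintro x hx rfl
    have := hsupp hx
    rw [mem_closedBall_iff_norm, zero_sub, norm_neg] at this
    linarith
  have hvneg : ∀ x ∈ tsupport (laplacian Γ), laplacian (laplacian u) x < 0 :=
    fun x hx => hball x (Metric.closedBall_subset_ball hσδ (hsupp hx))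
  have hc : HasCompactSupport (laplacian Γ) :=
    (isCompact_closedBall x₀ σ).of_isClosed_subset (isClosed_tsupport _) hsupp
  have hne' : ∀ x ∈ tsupport (laplacian (laplacian Γ)), x ≠ 0 :=
    fun x hx => hne x (tsupport_laplacian_subset _ hx)
  have hle := hu.integral_mul_laplacian_iterate_fundamental_nonpos hn (cN_pos hn) hx₀
    (by linarith) hΓ hΓ0 hΓ1 hΓ2 (integrable_mul_of_tsupport
      (fun x hx => (hu.contDiffAt x (hne' x (tsupport_laplacian_subset _ hx))).continuousAt)
      hΓ.laplacian.laplacian.laplacian.continuous hc.laplacian.laplacian)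
  rw [← integral_laplacian_mul (fun x hx => (hu.contDiffAt x (hne' x hx)).of_le (by norm_num))
    hΓ.laplacian.laplacian hc.laplacian,
    ← integral_laplacian_mul (fun x hx => (hu4 x (hne x hx)).of_le (by norm_num))
    hΓ.laplacian hc] at hle
  have hcont : Continuous fun x => laplacian (laplacian u) x * laplacian Γ x :=
    continuous_of_tsupport fun x hx =>
      (hu2 x (hne x (closure_mono (Function.support_mul_subset_right _ _) hx))).continuousAt.mul
        hΓ.laplacian.continuous.continuousAt
  have hyv : laplacian (laplacian u) y < 0 := hvneg y (subset_tsupport _ hy.ne)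
  refine absurd hle (not_le.2 (hcont.integral_pos_of_hasCompactSupport_nonneg_nonzero hc.mul_left
    (fun x => ?_) (mul_pos_of_neg_of_neg hyv hy).ne'))
  by_cases hx : x ∈ tsupport (laplacian Γ)
  · exact mul_nonneg_of_nonpos_of_nonpos (hvneg x hx).le (hΓL x)
  · simp [image_eq_zero_of_notMem_tsupport hx]
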